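/- Let Ω be a finite set and let G be a solvable subgroup of the symmetric group on Ω acting primitively on Ω. If |Ω| ≥ 49, or |Ω| = 25, or |Ω| = 32, then (G, Ω) is nice: there exist subsets Δ₁, Δ₂ of Ω with |Δ₁| < |Δ₂| and 2|Δ₂| ≤ |Ω| such that for j = 1, 2, the setwise stabilizer of Δ_j in G has a normal elementary abelian 3-subgroup (possibly trivial) with 2-group quotient. -/

import Mathlib

open Pointwise

/-- A finite group `S` has the "required structure" if it has a (possibly trivial) normal
elementary abelian 3-subgroup `N` such that the quotient `S/N` is a 2-group. -/
def RequiredStructure (S : Type*) [Group S] : Prop :=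
  ∃ (N : Subgroup S) (hN : N.Normal),
    (∀ x ∈ N, ∀ y ∈ N, x * y = y * x) ∧ (∀ x ∈ N, x ^ 3 = 1) ∧
    @IsPGroup 2 (S ⧸ N) (@QuotientGroup.Quotient.group S _ N hN)

/-- A finite permutation group `(G, Ω)` is "nice" if there are subsets `Δ₁, Δ₂` of `Ω`
with `|Δ₁| < |Δ₂| ≤ |Ω|/2` whose setwise stabilizers in `G` both have the required
structure. -/
def IsNice (Ω : Type*) [Fintype Ω] (G : Subgroup (Equiv.Perm Ω)) : Prop :=
  ∃ Δ₁ Δ₂ : Set Ω, Δ₁.ncard < Δ₂.ncard ∧ 2 * Δ₂.ncard ≤ Fintype.card Ω ∧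
    RequiredStructure (MulAction.stabilizer G Δ₁) ∧
    RequiredStructure (MulAction.stabilizer G Δ₂)

/-- A permutation group `(G, Ω)` is primitive if it is transitive and every block is trivial. -/
def IsPrimitivePermGroup (Ω : Type*) [Fintype Ω] (G : Subgroup (Equiv.Perm Ω)) : Prop :=
  MulAction.IsPretransitive G Ω ∧
    ∀ B : Set Ω, MulAction.IsBlock G B → MulAction.IsTrivialBlock B

/-- No element of odd prime order in `G` leaves the set `Δ` invariant. -/
def IsOddFree {Ω : Type*} (G : Subgroup (Equiv.Perm Ω)) (Δ : Finset Ω) : Prop :=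
  ∀ g ∈ G, (orderOf g).Prime → orderOf g ≠ 2 → ∃ x, ¬ (g x ∈ Δ ↔ x ∈ Δ)

lemma IsOddFree.compl {Ω : Type*} [Fintype Ω] [DecidableEq Ω] {G : Subgroup (Equiv.Perm Ω)}
    {Δ : Finset Ω} (h : IsOddFree G Δ) : IsOddFree G Δᶜ := by
  intro g hg h1 h2
  obtain ⟨x, hx⟩ := h g hg h1 h2
  exact ⟨x, by rwa [Finset.mem_compl, Finset.mem_compl, not_iff_not]⟩

lemma requiredStructure_of_isPGroup {S : Type*} [Group S] (h : IsPGroup 2 S) :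
    RequiredStructure S := by
  refine ⟨⊥, inferInstance, ?_, ?_, h.to_quotient ⊥⟩ <;> simp +contextual

lemma IsOddFree.requiredStructure {Ω : Type*} [Finite Ω] {G : Subgroup (Equiv.Perm Ω)}
    {Δ : Finset Ω} (h : IsOddFree G Δ) :
    RequiredStructure (MulAction.stabilizer G (Δ : Set Ω)) := by
  apply requiredStructure_of_isPGroup
  rw [IsPGroup.iff_orderOf]
  intro s
  refine ⟨_, Nat.eq_prime_pow_of_unique_prime_dvd (orderOf_pos s).ne' fun {r} hr hd => ?_⟩
  by_contra hr2
  obtain ⟨u, hu⟩ : ∃ u : MulAction.stabilizer G (Δ : Set Ω), orderOf u = r :=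
    ⟨_, orderOf_pow_orderOf_div (orderOf_pos s).ne' hd⟩
  have hu' : orderOf (u : G).1 = r := by rw [Subgroup.orderOf_coe, Subgroup.orderOf_coe, hu]
  obtain ⟨x, hx⟩ := h _ (u : G).2 (hu' ▸ hr) (hu' ▸ hr2)
  exact hx (MulAction.mem_stabilizer_set.1 u.2 x)

lemma isNice_of_isOddFree {Ω : Type*} [Fintype Ω] {G : Subgroup (Equiv.Perm Ω)}
    {Δ₁ Δ₂ : Finset Ω} (h₁ : IsOddFree G Δ₁) (h₂ : IsOddFree G Δ₂) (h : Δ₁.card < Δ₂.card)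
    (h' : 2 * Δ₂.card ≤ Fintype.card Ω) : IsNice Ω G :=
  ⟨Δ₁, Δ₂, by simpa only [Set.ncard_coe_finset], by simpa only [Set.ncard_coe_finset],
    h₁.requiredStructure, h₂.requiredStructure⟩

lemma choose_le_two_pow_sub_two {n : ℕ} (hn : 9 ≤ n) (m : ℕ) : n.choose m ≤ 2 ^ (n - 2) := by
  induction n, hn using Nat.le_induction generalizing m with
  | base =>
    rcases le_or_gt m 9 with h | h
    · interval_cases m <;> decide
    · simp [Nat.choose_eq_zero_of_lt h]
  | succ n hn ih =>
    obtain ⟨j, rfl⟩ := Nat.exists_eq_add_of_le' hn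
    cases m with
    | zero => simp [Nat.one_le_two_pow]
    | succ m =>
      have h1 := ih m
      have h2 := ih m.succ
      have h3 : 2 ^ (j + 9 + 1 - 2) = 2 * 2 ^ (j + 9 - 2) := by
        rw [← pow_succ']; congr 1
      rw [Nat.choose_succ_succ, h3]
      omega

/-- A family of more than half of all subsets which is closed under complements contains
members of two different sizes that are at most half of the size of the whole set. -/
lemma exists_card_lt_card_of_compl {Ω : Type*} [Fintype Ω] [DecidableEq Ω]
    (hn : 9 ≤ Fintype.card Ω) (P : Finset Ω → Prop) [DecidablePred P]
    (hP : ∀ s, P s → P sᶜ)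
    (hbad : (Finset.univ.filter fun s => ¬ P s).card < 2 ^ (Fintype.card Ω - 1)) :
    ∃ s t, P s ∧ P t ∧ s.card < t.card ∧ 2 * t.card ≤ Fintype.card Ω := by
  obtain ⟨j, hj⟩ := Nat.exists_eq_add_of_le' hn
  have htot : (Finset.univ.filter fun s => P s).card +
      (Finset.univ.filter fun s => ¬ P s).card = 2 ^ Fintype.card Ω := by
    rw [Finset.card_filter_add_card_filter_not, Finset.card_univ, Fintype.card_finset]
  have hgood : 2 ^ (Fintype.card Ω - 1) < (Finset.univ.filter fun s => P s).card := by
    have : 2 ^ Fintype.card Ω = 2 * 2 ^ (Fintype.card Ω - 1) := by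
      rw [← pow_succ']; congr 1; omega
    omega
  by_contra! hcon
  have hhalf : ∀ s, P s → P sᶜ ∧ s.card + sᶜ.card = Fintype.card Ω := fun s hs =>
    ⟨hP s hs, Finset.card_add_card_compl s⟩
  have hex : ∃ s, P s ∧ 2 * s.card ≤ Fintype.card Ω := by
    obtain ⟨s, hs⟩ := Finset.card_pos.1 (Nat.zero_lt_of_lt hgood)
    have hs := (Finset.mem_filter.1 hs).2
    obtain ⟨h1, h2⟩ := hhalf s hs
    rcases le_or_gt (2 * s.card) (Fintype.card Ω) with h | h
    · exact ⟨s, hs, h⟩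
    · exact ⟨sᶜ, h1, by omega⟩
  obtain ⟨s, hs, hs2⟩ := hex
  have huniq : ∀ t, P t → 2 * t.card ≤ Fintype.card Ω → t.card = s.card := by
    intro t ht ht2
    rcases lt_trichotomy t.card s.card with h | h | h
    · exact absurd (hcon t s ht hs h) (by omega)
    · exact h
    · exact absurd (hcon s t hs ht h) (by omega)
  have hsub : (Finset.univ.filter fun s => P s) ⊆
      Finset.powersetCard s.card Finset.univ ∪
        Finset.powersetCard (Fintype.card Ω - s.card) Finset.univ := by
    intro t ht
    have ht := (Finset.mem_filter.1 ht).2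
    obtain ⟨h1, h2⟩ := hhalf t ht
    simp only [Finset.mem_union, Finset.mem_powersetCard_univ]
    rcases le_or_gt (2 * t.card) (Fintype.card Ω) with h | h
    · exact Or.inl (huniq t ht h)
    · have := huniq _ h1 (by omega)
      omega
  have h1 := (Finset.card_le_card hsub).trans (Finset.card_union_le _ _)
  rw [Finset.card_powersetCard, Finset.card_powersetCard, Finset.card_univ] at h1
  have h2 := choose_le_two_pow_sub_two hn s.card
  have h3 := choose_le_two_pow_sub_two hn (Fintype.card Ω - s.card)
  have h4 : 2 ^ (Fintype.card Ω - 1) = 2 * 2 ^ (Fintype.card Ω - 2) := by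
    rw [← pow_succ']; congr 1; omega
  omega

lemma card_invariant_finsets_le {Ω : Type*} [Fintype Ω] [DecidableEq Ω] (g : Equiv.Perm Ω) :
    (Finset.univ.filter fun s : Finset Ω => ∀ x, g x ∈ s ↔ x ∈ s).card ≤
      2 ^ Nat.card (MulAction.orbitRel.Quotient (Subgroup.zpowers g) Ω) := by
  classical
  rw [Nat.card_eq_fintype_card, ← Fintype.card_finset, ← Finset.card_univ]
  let q : Ω → MulAction.orbitRel.Quotient (Subgroup.zpowers g) Ω := Quotient.mk _
  refine Finset.card_le_card_of_surjOn (fun T => Finset.univ.filter fun x => q x ∈ T)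
    fun s hs => ?_
  have hs : ∀ x, g x ∈ s ↔ x ∈ s := by simpa using hs
  have hinv : Subgroup.zpowers g ≤ MulAction.stabilizer _ (s : Set Ω) := by
    rw [Subgroup.zpowers_le, MulAction.mem_stabilizer_set]
    simpa using hs
  refine ⟨s.image q, by simp, ?_⟩
  ext x
  simp only [Finset.mem_filter, Finset.mem_univ, true_and, Finset.mem_image]
  refine ⟨fun ⟨y, hy, hyx⟩ => ?_, fun hx => ⟨x, hx, rfl⟩⟩
  obtain ⟨h, rfl⟩ := MulAction.orbitRel_apply.1 (Quotient.exact hyx)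
  exact (MulAction.mem_stabilizer_set.1 (hinv h.2) x).1 hy

lemma card_orbits_le {Ω : Type*} [Fintype Ω] {g : Equiv.Perm Ω} (hg : (orderOf g).Prime)
    (hg2 : orderOf g ≠ 2) {F : ℕ} (hFn : F ≤ Fintype.card Ω)
    (hF : ∀ h ∈ Subgroup.zpowers g, h ≠ 1 → Nat.card (MulAction.fixedBy Ω h) ≤ F) :
    3 * Nat.card (MulAction.orbitRel.Quotient (Subgroup.zpowers g) Ω) ≤
      Fintype.card Ω + 2 * F := by
  classical
  have hB := MulAction.sum_card_fixedBy_eq_card_orbits_mul_card_group (Subgroup.zpowers g) Ω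
  simp only [← Nat.card_eq_fintype_card, Nat.card_zpowers] at hB
  have h1 : ∑ h : Subgroup.zpowers g, Nat.card (MulAction.fixedBy Ω h) ≤
      Fintype.card Ω + (orderOf g - 1) * F := by
    rw [← Finset.add_sum_erase _ _ (Finset.mem_univ 1)]
    refine add_le_add ?_ ?_
    · rw [← Nat.card_eq_fintype_card]
      exact Nat.card_le_card_of_injective _ Subtype.val_injective
    · refine (Finset.sum_le_card_nsmul _ _ F fun h hh => ?_).trans ?_
      · exact hF h h.2 fun h1 => (Finset.mem_erase.1 hh).1 (Subtype.ext h1)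
      · rw [Finset.card_erase_of_mem (Finset.mem_univ _), Finset.card_univ,
          ← Nat.card_eq_fintype_card, Nat.card_zpowers, smul_eq_mul]
  rw [hB] at h1
  obtain ⟨j, hj⟩ : ∃ j, orderOf g = j + 3 := Nat.exists_eq_add_of_le' (by
    have := hg.two_le
    omega)
  rw [hj] at h1
  obtain ⟨i, hi⟩ := Nat.exists_eq_add_of_le hFn
  rw [hi] at h1 ⊢
  simp only [Nat.reduceSubDiff] at h1
  generalize Nat.card _ = N at *
  have h2 : (j + 3) * (3 * N) ≤ (j + 3) * (F + i + 2 * F) := by nlinarith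
  exact Nat.le_of_mul_le_mul_left h2 (by omega)

lemma isNice_of_card_mul_two_pow_lt {Ω : Type*} [Fintype Ω] (G : Subgroup (Equiv.Perm Ω))
    (hn : 9 ≤ Fintype.card Ω) {F : ℕ} (hFn : F ≤ Fintype.card Ω)
    (hF : ∀ g ∈ G, (orderOf g).Prime → orderOf g ≠ 2 → Nat.card (MulAction.fixedBy Ω g) ≤ F)
    (hG : Nat.card G * 2 ^ ((Fintype.card Ω + 2 * F) / 3) < 2 ^ (Fintype.card Ω - 1)) :
    IsNice Ω G := by
  classical
  suffices hbad : (Finset.univ.filter fun s => ¬ IsOddFree G s).card <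
      2 ^ (Fintype.card Ω - 1) by
    obtain ⟨s, t, hs, ht, hst, htn⟩ := exists_card_lt_card_of_compl hn (IsOddFree G)
      (fun s hs => hs.compl) hbad
    exact isNice_of_isOddFree hs ht hst htn
  let T : Finset (Equiv.Perm Ω) :=
    Finset.univ.filter fun g => g ∈ G ∧ (orderOf g).Prime ∧ orderOf g ≠ 2
  have hT : T.card ≤ Nat.card G := by
    rw [Nat.card_eq_fintype_card, Fintype.card_subtype]
    exact Finset.card_le_card (Finset.monotone_filter_right _ fun g _ hg => hg.1)
  refine lt_of_le_of_lt ?_ hG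
  calc _ ≤ (T.biUnion fun g => Finset.univ.filter fun s : Finset Ω => ∀ x, g x ∈ s ↔ x ∈ s).card :=
        Finset.card_le_card fun s hs => by
          have hs := (Finset.mem_filter.1 hs).2
          simp only [IsOddFree] at hs
          push Not at hs
          obtain ⟨g, hg, h1, h2, h3⟩ := hs
          simp only [Finset.mem_biUnion, Finset.mem_filter, Finset.mem_univ, true_and, T]
          exact ⟨g, ⟨hg, h1, h2⟩, fun x => by have := h3 x; tauto⟩
    _ ≤ T.card * 2 ^ ((Fintype.card Ω + 2 * F) / 3) :=
        Finset.card_biUnion_le_card_mul _ _ _ fun g hg => by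
          obtain ⟨hg, h1, h2⟩ := (Finset.mem_filter.1 hg).2
          refine (card_invariant_finsets_le g).trans (Nat.pow_le_pow_right two_pos ?_)
          rw [Nat.le_div_iff_mul_le three_pos, mul_comm]
          refine card_orbits_le h1 h2 hFn fun h hh hne => ?_
          have h3 : orderOf h = orderOf g :=
            ((Nat.dvd_prime h1).1 (orderOf_dvd_of_mem_zpowers hh)).resolve_left
              (by rwa [orderOf_eq_one_iff])
          exact hF h (Subgroup.zpowers_le.2 hg hh) (h3 ▸ h1) (h3 ▸ h2)
    _ ≤ _ := Nat.mul_le_mul_right _ hT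

lemma card_eq_pow_of_equiv {Ω : Type*} [Fintype Ω] {p k : ℕ} (e : Ω ≃ (Fin k → ZMod p)) :
    Fintype.card Ω = p ^ k := by
  rw [← Nat.card_eq_fintype_card, Nat.card_congr e, Nat.card_fun, Nat.card_fin, Nat.card_zmod]

/-- In the coordinates `e`, every element of `G` is an affine map. -/
def IsAffineIn {Ω : Type*} {p k : ℕ} (e : Ω ≃ (Fin k → ZMod p))
    (G : Subgroup (Equiv.Perm Ω)) : Prop :=
  ∀ g ∈ G, ∃ (φ : (Fin k → ZMod p) →+ (Fin k → ZMod p)) (t : Fin k → ZMod p),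
    ∀ x, e (g x) = φ (e x) + t

/-- An affine permutation is determined by the images of the origin and of the standard basis. -/
lemma IsAffineIn.ext {Ω : Type*} {p k : ℕ} {e : Ω ≃ (Fin k → ZMod p)}
    {G : Subgroup (Equiv.Perm Ω)} (h : IsAffineIn e G) {g g' : Equiv.Perm Ω} (hg : g ∈ G)
    (hg' : g' ∈ G) (h0 : g (e.symm 0) = g' (e.symm 0))
    (h1 : ∀ i, g (e.symm (Pi.single i 1)) = g' (e.symm (Pi.single i 1))) : g = g' := by
  obtain ⟨φ, t, hφ⟩ := h g hg
  obtain ⟨ψ, s, hψ⟩ := h g' hg'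
  obtain rfl : t = s := by
    simpa [h0, hψ] using (hφ (e.symm 0)).symm
  have hlin : φ.toZModLinearMap p = ψ.toZModLinearMap p := by
    refine LinearMap.pi_ext' fun i => LinearMap.ext_ring ?_
    have := hφ (e.symm (Pi.single i 1))
    rw [h1, hψ] at this
    simpa using this.symm
  ext x
  apply e.injective
  rw [hφ, hψ]
  congr 1
  exact DFunLike.congr_fun hlin (e x)

lemma IsAffineIn.card_le {Ω : Type*} [Fintype Ω] {p k : ℕ} {e : Ω ≃ (Fin k → ZMod p)}
    {G : Subgroup (Equiv.Perm Ω)} (h : IsAffineIn e G) :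
    Nat.card G ≤ Fintype.card Ω ^ (k + 1) := by
  have := Nat.card_le_card_of_injective
    (fun g : G => ((g : Equiv.Perm Ω) (e.symm 0),
      fun i => (g : Equiv.Perm Ω) (e.symm (Pi.single i 1)))) fun g g' hgg => by
    rw [Prod.mk.injEq] at hgg
    exact Subtype.ext (h.ext g.2 g'.2 hgg.1 (congrFun hgg.2))
  rwa [Nat.card_prod, Nat.card_fun, Nat.card_eq_fintype_card (α := Ω), Nat.card_fin,
    ← pow_succ'] at this

lemma IsAffineIn.card_fixedBy {Ω : Type*} {p k : ℕ} (hp : p.Prime)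
    {e : Ω ≃ (Fin k → ZMod p)} {G : Subgroup (Equiv.Perm Ω)} (h : IsAffineIn e G)
    {g : Equiv.Perm Ω} (hg : g ∈ G) (hg1 : g ≠ 1) :
    Nat.card (MulAction.fixedBy Ω g) = 0 ∨
      ∃ i < k, Nat.card (MulAction.fixedBy Ω g) = p ^ i := by
  have := Fact.mk hp
  rcases (MulAction.fixedBy Ω g).eq_empty_or_nonempty with h0 | ⟨c, hc⟩
  · left
    simp [h0]
  right
  obtain ⟨φ, t, hφ⟩ := h g hg
  have hc : g c = c := hc
  have ht : t = e c - φ (e c) := by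
    rw [eq_sub_iff_add_eq', ← hφ, hc]
  have hfix : ∀ x, x ∈ MulAction.fixedBy Ω g ↔ e x - e c ∈ (φ - AddMonoidHom.id _).ker := by
    intro x
    rw [MulAction.mem_fixedBy, Equiv.Perm.smul_def, ← e.apply_eq_iff_eq, hφ, ht,
      AddMonoidHom.mem_ker, AddMonoidHom.sub_apply, map_sub, AddMonoidHom.id_apply,
      sub_eq_zero, ← sub_eq_zero, ← sub_eq_zero (b := e x - e c)]
    constructor <;> intro h <;> rw [← h] <;> abel
  have hcard : Nat.card (MulAction.fixedBy Ω g) = Nat.card (φ - AddMonoidHom.id _).ker :=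
    Nat.card_congr ((e.trans (Equiv.subRight (e c))).subtypeEquiv hfix)
  have hdvd := AddSubgroup.card_addSubgroup_dvd_card (φ - AddMonoidHom.id _).ker
  rw [← hcard, Nat.card_fun, Nat.card_fin, Nat.card_zmod] at hdvd
  obtain ⟨i, hi, hip⟩ := (Nat.dvd_prime_pow hp).1 hdvd
  refine ⟨i, lt_of_le_of_ne hi ?_, hip⟩
  rintro rfl
  apply hg1
  have htop := AddSubgroup.eq_top_of_card_eq (φ - AddMonoidHom.id _).ker
    (by rw [← hcard, hip, Nat.card_fun, Nat.card_fin, Nat.card_zmod])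
  ext x
  exact (hfix x).2 (htop ▸ AddSubgroup.mem_top _)

lemma IsAffineIn.mul_card_fixedBy_le {Ω : Type*} [Fintype Ω] {p k : ℕ} (hp : p.Prime)
    {e : Ω ≃ (Fin k → ZMod p)} {G : Subgroup (Equiv.Perm Ω)} (h : IsAffineIn e G)
    {g : Equiv.Perm Ω} (hg : g ∈ G) (hg1 : g ≠ 1) :
    p * Nat.card (MulAction.fixedBy Ω g) ≤ Fintype.card Ω := by
  have hcard : Fintype.card Ω = p ^ k := card_eq_pow_of_equiv e
  rcases h.card_fixedBy hp hg hg1 with h0 | ⟨i, hi, hip⟩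
  · simp [h0]
  · rw [hip, hcard, ← pow_succ']
    exact Nat.pow_le_pow_right hp.pos hi

lemma IsAffineIn.four_mul_card_fixedBy_le {Ω : Type*} [Fintype Ω] {k : ℕ}
    {e : Ω ≃ (Fin k → ZMod 2)} {G : Subgroup (Equiv.Perm Ω)} (h : IsAffineIn e G)
    {g : Equiv.Perm Ω} (hg : g ∈ G) (hr : (orderOf g).Prime) (hr2 : orderOf g ≠ 2) :
    4 * Nat.card (MulAction.fixedBy Ω g) ≤ Fintype.card Ω := by
  have hcard : Fintype.card Ω = 2 ^ k := card_eq_pow_of_equiv e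
  have hg1 : g ≠ 1 := by
    rintro rfl
    rw [orderOf_one] at hr
    exact Nat.not_prime_one hr
  rcases h.card_fixedBy Nat.prime_two hg hg1 with h0 | ⟨i, hi, hip⟩
  · simp [h0]
  rw [hip, hcard, show 4 = 2 ^ 2 from rfl, ← pow_add]
  refine Nat.pow_le_pow_right two_pos ?_
  by_contra hlt
  obtain rfl : k = i + 1 := by omega
  have := Fact.mk hr
  have hpg : IsPGroup (orderOf g) (Subgroup.zpowers g) :=
    IsPGroup.of_card (n := 1) (by rw [Nat.card_zpowers, pow_one])
  have hmod := hpg.card_modEq_card_fixedPoints Ω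
  have hfp : MulAction.fixedPoints (Subgroup.zpowers g) Ω = MulAction.fixedBy Ω g := by
    ext x
    refine ⟨fun hx => hx ⟨g, Subgroup.mem_zpowers g⟩, fun hx s => ?_⟩
    have : Subgroup.zpowers g ≤ MulAction.stabilizer _ x := by
      rwa [Subgroup.zpowers_le]
    exact this s.2
  rw [hfp, hip, Nat.card_eq_fintype_card, hcard] at hmod
  have hdvd := (Nat.modEq_iff_dvd' (Nat.pow_le_pow_right two_pos i.le_succ)).1 hmod.symm
  rw [pow_succ, mul_two, Nat.add_sub_cancel] at hdvd
  exact hr2 ((Nat.prime_dvd_prime_iff_eq hr Nat.prime_two).1 (hr.dvd_of_dvd_pow hdvd))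

lemma mul_succ_lt_two_pow {k : ℕ} (hk : 7 ≤ k) : k * (k + 1) + 1 < 2 ^ (k - 1) := by
  induction k, hk using Nat.le_induction with
  | base => norm_num
  | succ k hk ih =>
    obtain ⟨j, rfl⟩ := Nat.exists_eq_add_of_le' hk
    rw [show j + 7 + 1 - 1 = (j + 7 - 1) + 1 by omega, pow_succ]
    nlinarith

lemma mul_add_nine_le_two_pow {L : ℕ} (hL : 7 ≤ L) :
    3 * ((L + 1) * (2 * L + 4)) + 9 ≤ 4 * 2 ^ L := by
  induction L, hL using Nat.le_induction with
  | base => norm_num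
  | succ L hL ih =>
    rw [pow_succ]
    nlinarith

lemma two_pow_pow_mul_lt {k : ℕ} (hk : 7 ≤ k) :
    (2 ^ k) ^ (k + 1) * 2 ^ ((2 ^ k + 2 * (2 ^ k / 4)) / 3) < 2 ^ (2 ^ k - 1) := by
  rw [← pow_mul, ← pow_add]
  refine Nat.pow_lt_pow_right one_lt_two ?_
  have h := mul_succ_lt_two_pow hk
  obtain ⟨j, rfl⟩ := Nat.exists_eq_add_of_le' hk
  have h1 : 2 ^ (j + 7) = 4 * 2 ^ (j + 5) := by ring
  have h2 : 2 ^ (j + 7 - 1) = 2 * 2 ^ (j + 5) := by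
    rw [← pow_succ']; congr 1
  omega

lemma odd_prime_pow_pow_mul_lt {p k : ℕ} (hp : p.Prime) (hp2 : p ≠ 2) (hn : 49 ≤ p ^ k) :
    (p ^ k) ^ (k + 1) * 2 ^ ((p ^ k + 2 * (p ^ k / 3)) / 3) < 2 ^ (p ^ k - 1) := by
  have hp3 : 3 ≤ p := by
    have := hp.two_le
    omega
  have key : ∀ {m : ℕ}, (p ^ k) ^ (k + 1) < 2 ^ m →
      m + (p ^ k + 2 * (p ^ k / 3)) / 3 ≤ p ^ k - 1 →
      (p ^ k) ^ (k + 1) * 2 ^ ((p ^ k + 2 * (p ^ k / 3)) / 3) < 2 ^ (p ^ k - 1) :=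
    fun {m} h1 h2 => calc
      _ < 2 ^ m * 2 ^ ((p ^ k + 2 * (p ^ k / 3)) / 3) :=
        Nat.mul_lt_mul_of_pos_right h1 (by positivity)
      _ = 2 ^ (m + (p ^ k + 2 * (p ^ k / 3)) / 3) := (pow_add _ _ _).symm
      _ ≤ _ := Nat.pow_le_pow_right two_pos h2
  rcases lt_or_ge (p ^ k) 128 with hlt | hge
  · have hk : k < 5 := by
      by_contra! h
      have := (Nat.pow_le_pow_left hp3 5).trans (Nat.pow_le_pow_right hp.pos h)
      omega
    rcases lt_or_ge k 3 with hk3 | hk3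
    · refine key (m := 21) ?_ (by omega)
      calc (p ^ k) ^ (k + 1) ≤ (p ^ k) ^ 3 := Nat.pow_le_pow_right (by omega) (by omega)
        _ < 128 ^ 3 := Nat.pow_lt_pow_left hlt (by norm_num)
        _ = 2 ^ 21 := by norm_num
    · have hp5 : p ≤ 5 := by
        by_contra! h
        have := (Nat.pow_le_pow_left (show 6 ≤ p from h) 3).trans (Nat.pow_le_pow_right hp.pos hk3)
        omega
      interval_cases k <;> interval_cases p <;> norm_num at *
  · set L := Nat.log 2 (p ^ k) with hL
    have hL1 : p ^ k < 2 ^ (L + 1) := Nat.lt_pow_succ_log_self one_lt_two _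
    have hL2 : 2 ^ L ≤ p ^ k := Nat.pow_log_le_self 2 (by omega)
    have hL7 : 7 ≤ L := Nat.le_log_of_pow_le one_lt_two hge
    have h3k : 3 * k < 2 * (L + 1) := by
      rw [← Nat.pow_lt_pow_iff_right one_lt_two]
      calc 2 ^ (3 * k) = (2 ^ 3) ^ k := pow_mul _ _ _
        _ ≤ (3 ^ 2) ^ k := Nat.pow_le_pow_left (by norm_num) k
        _ = (3 ^ k) ^ 2 := by rw [← pow_mul, ← pow_mul, mul_comm]
        _ ≤ (p ^ k) ^ 2 := Nat.pow_le_pow_left (Nat.pow_le_pow_left hp3 k) 2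
        _ < (2 ^ (L + 1)) ^ 2 := Nat.pow_lt_pow_left hL1 two_ne_zero
        _ = 2 ^ (2 * (L + 1)) := by rw [← pow_mul, mul_comm]
    refine key (m := (L + 1) * (k + 1)) ?_ ?_
    · rw [pow_mul]
      exact Nat.pow_lt_pow_left hL1 k.succ_ne_zero
    · have h1 := mul_add_nine_le_two_pow hL7
      have h2 : 3 * ((L + 1) * (k + 1)) ≤ (L + 1) * (2 * L + 4) := by nlinarith
      generalize (L + 1) * (k + 1) = A at *
      omega

lemma IsAffineIn.isNice_of_two {Ω : Type*} [Fintype Ω] {k : ℕ} {e : Ω ≃ (Fin k → ZMod 2)}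
    {G : Subgroup (Equiv.Perm Ω)} (h : IsAffineIn e G) (hk : 7 ≤ k) : IsNice Ω G := by
  have hcard : Fintype.card Ω = 2 ^ k := card_eq_pow_of_equiv e
  have hn : 2 ^ 7 ≤ Fintype.card Ω := hcard ▸ Nat.pow_le_pow_right two_pos hk
  refine isNice_of_card_mul_two_pow_lt G (by omega) (F := Fintype.card Ω / 4) (by omega)
    (fun g hg h1 h2 => ?_) ?_
  · have := h.four_mul_card_fixedBy_le hg h1 h2
    omega
  · refine (Nat.mul_le_mul_right _ h.card_le).trans_lt ?_
    rw [hcard]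
    exact two_pow_pow_mul_lt hk

lemma IsAffineIn.isNice_of_ne_two {Ω : Type*} [Fintype Ω] {p k : ℕ} (hp : p.Prime) (hp2 : p ≠ 2)
    {e : Ω ≃ (Fin k → ZMod p)} {G : Subgroup (Equiv.Perm Ω)} (h : IsAffineIn e G)
    (hn : 49 ≤ Fintype.card Ω) : IsNice Ω G := by
  have hcard : Fintype.card Ω = p ^ k := card_eq_pow_of_equiv e
  refine isNice_of_card_mul_two_pow_lt G (by omega) (F := Fintype.card Ω / 3) (by omega)
    (fun g hg h1 h2 => ?_) ?_
  · have hg1 : g ≠ 1 := by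
      rintro rfl
      rw [orderOf_one] at h1
      exact Nat.not_prime_one h1
    rw [Nat.le_div_iff_mul_le three_pos, mul_comm]
    refine le_trans (Nat.mul_le_mul_right _ ?_) (h.mul_card_fixedBy_le hp hg hg1)
    have := hp.two_le
    omega
  · refine (Nat.mul_le_mul_right _ h.card_le).trans_lt ?_
    rw [hcard] at hn ⊢
    exact odd_prime_pow_pow_mul_lt hp hp2 hn

/-- The number of ways to complete `y` to a triple `(y, u, v)` with `u`, `v` and `op y u v`
in `D`. -/
def completions {X : Type*} [DecidableEq X] (op : X → X → X → X) (D : Finset X) (y : X) : ℕ :=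
  ((D ×ˢ D).filter fun q => op y q.1 q.2 ∈ D).card

lemma completions_perm {X : Type*} [DecidableEq X] {op : X → X → X → X} {D : Finset X}
    (σ : Equiv.Perm X) (hop : ∀ x y z, σ (op x y z) = op (σ x) (σ y) (σ z))
    (hD : ∀ x, σ x ∈ D ↔ x ∈ D) (y : X) : completions op D (σ y) = completions op D y := by
  symm
  refine Finset.card_equiv (σ.prodCongr σ) fun q => ?_
  simp [← hop, hD]

/-- Points whose colour is shared by at most one other point are fixed by all colour preserving
permutations of odd order. -/
lemma apply_eq_self_of_card_le_two {X C : Type*} [Fintype X] [DecidableEq C] (σ : Equiv.Perm X)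
    (hσ : Odd (orderOf σ)) {c : X → C} (hc : ∀ x, c (σ x) = c x) {x : X}
    (hx : (Finset.univ.filter fun y => c y = c x).card ≤ 2) : σ x = x := by
  classical
  by_contra hne
  have h2 : σ (σ x) = x := by
    by_contra h2
    have hsub : {x, σ x, σ (σ x)} ⊆ Finset.univ.filter fun y => c y = c x := by
      intro y hy
      simp only [Finset.mem_insert, Finset.mem_singleton] at hy
      rcases hy with rfl | rfl | rfl <;> simp [hc]
    have := Finset.card_le_card hsub
    rw [Finset.card_eq_three.2 ⟨x, σ x, σ (σ x), Ne.symm hne, Ne.symm h2,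
      fun h => hne (σ.injective h).symm, rfl⟩] at this
    omega
  have hmem : σ ^ 2 ∈ MulAction.stabilizer (Equiv.Perm X) x := by
    rw [pow_two]
    exact h2
  obtain ⟨j, hj⟩ := hσ
  have h3 : (σ ^ 2)⁻¹ ^ j = σ := by
    rw [inv_pow, inv_eq_iff_mul_eq_one, ← pow_mul, ← pow_succ, ← hj, pow_orderOf_eq_one]
  have h4 := pow_mem (inv_mem hmem) j
  rw [h3] at h4
  exact hne h4

/-- A set is invariant under no element of odd prime order if the numbers of completions
separate the origin and the standard basis well enough from the other points. -/
lemma IsAffineIn.isOddFree_map {Ω X : Type*} [Fintype X] [DecidableEq X] {p k : ℕ}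
    {e : Ω ≃ (Fin k → ZMod p)} {G : Subgroup (Equiv.Perm Ω)} (h : IsAffineIn e G)
    (f : X ≃ (Fin k → ZMod p)) {op : X → X → X → X}
    (hf : ∀ x y z, f (op x y z) = f x + f y - f z) {D : Finset X} {c : X → ℕ}
    (hc : ∀ y, completions op D y = c y) {x₀ : X} {b : Fin k → X} (hx₀ : f x₀ = 0)
    (hb : ∀ i, f (b i) = Pi.single i 1)
    (h₀ : (Finset.univ.filter fun y => c y = c x₀).card ≤ 2)
    (h₁ : ∀ i, (Finset.univ.filter fun y => c y = c (b i)).card ≤ 2) :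
    IsOddFree G (D.map (f.trans e.symm).toEmbedding) := by
  intro g hg hr hr2
  by_contra! hinv
  let u : X ≃ Ω := f.trans e.symm
  let σ : Equiv.Perm X := u.symm.permCongr g
  have hgσ : ∀ x, u (σ x) = g (u x) := fun x => by simp [σ, Equiv.permCongr_apply]
  have hord : orderOf σ = orderOf g :=
    orderOf_injective u.symm.permCongrHom.toMonoidHom u.symm.permCongrHom.injective g
  have hσD : ∀ x, σ x ∈ D ↔ x ∈ D := by
    intro x
    have := hinv (u x)
    rw [← hgσ] at this
    simpa [u] using this
  have hσop : ∀ x y z, σ (op x y z) = op (σ x) (σ y) (σ z) := by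
    obtain ⟨φ, t, hφ⟩ := h g hg
    have h1 : ∀ x, f (σ x) = φ (f x) + t := fun x => by
      have := congrArg e (hgσ x)
      simpa [u, hφ] using this
    intro x y z
    apply f.injective
    rw [h1, hf, hf, h1, h1, h1, map_sub, map_add]
    abel
  have hodd : Odd (orderOf σ) := hord ▸ hr.odd_of_ne_two hr2
  have hfix : ∀ {x : X}, (Finset.univ.filter fun y => c y = c x).card ≤ 2 → g (u x) = u x := by
    intro x hx
    rw [← hgσ, apply_eq_self_of_card_le_two σ hodd (fun y => ?_) hx]
    rw [← hc, ← hc, completions_perm σ hσop hσD]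
  have h1 : g = 1 := by
    refine h.ext hg G.one_mem ?_ fun i => ?_
    · rw [← hx₀]
      exact hfix h₀
    · rw [← hb]
      exact hfix (h₁ i)
  rw [h1, orderOf_one] at hr
  exact Nat.not_prime_one hr

lemma isNice_of_isOddFree_map {Ω X : Type*} [Fintype Ω] [Fintype X] {G : Subgroup (Equiv.Perm Ω)}
    {u : X ≃ Ω} {D₁ D₂ : Finset X} (h₁ : IsOddFree G (D₁.map u.toEmbedding))
    (h₂ : IsOddFree G (D₂.map u.toEmbedding)) (h : D₁.card < D₂.card)
    (h' : 2 * D₂.card ≤ Fintype.card X) : IsNice Ω G :=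
  isNice_of_isOddFree h₁ h₂ (by rwa [Finset.card_map, Finset.card_map])
    (by rwa [Finset.card_map, ← Fintype.card_congr u])

/-- Binary digits as coordinates. -/
noncomputable def bitsEquiv (k : ℕ) : Fin (2 ^ k) ≃ (Fin k → ZMod 2) :=
  Equiv.ofBijective (fun x i => if x.val.testBit i then 1 else 0) <| by
    rw [Fintype.bijective_iff_injective_and_card]
    refine ⟨fun x y hxy => Fin.ext (Nat.eq_of_testBit_eq fun i => ?_), by simp⟩
    rcases lt_or_ge i k with hi | hi
    · have := congrFun hxy ⟨i, hi⟩
      simp only at this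
      split_ifs at this <;> simp_all
    · have h2 : ∀ z : Fin (2 ^ k), z.val.testBit i = false := fun z =>
        Nat.testBit_lt_two_pow (z.2.trans_le (Nat.pow_le_pow_right two_pos hi))
      rw [h2, h2]

lemma bitsEquiv_apply {k : ℕ} (x : Fin (2 ^ k)) (i : Fin k) :
    bitsEquiv k x i = if x.val.testBit i then 1 else 0 := rfl

lemma bitsEquiv_zero {k : ℕ} : bitsEquiv k 0 = 0 := by
  ext i
  simp [bitsEquiv_apply]

lemma bitsEquiv_two_pow {k : ℕ} (i : Fin k) :
    bitsEquiv k ⟨2 ^ i.val, Nat.pow_lt_pow_right one_lt_two i.2⟩ = Pi.single i 1 := by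
  ext j
  simp [bitsEquiv_apply, Nat.testBit_two_pow, Pi.single_apply, Fin.ext_iff, eq_comm]

lemma bitsEquiv_xor {k : ℕ} (x y z : Fin (2 ^ k)) :
    bitsEquiv k (x ^^^ y ^^^ z) = bitsEquiv k x + bitsEquiv k y - bitsEquiv k z := by
  ext i
  have h2 : (1 + 1 : ZMod 2) = 0 := rfl
  simp only [bitsEquiv_apply, Pi.add_apply, Pi.sub_apply, Fin.xor_val_of_two_pow]
  cases hx : x.val.testBit i <;> cases hy : y.val.testBit i <;> cases hz : z.val.testBit i <;>
    simp [hx, hy, hz, h2]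

/-- The numbers below `2 ^ k` whose bits in `mask` are set. -/
def maskFinset (k mask : ℕ) : Finset (Fin (2 ^ k)) :=
  Finset.univ.filter fun x => mask.testBit x.val

/-- `completions` for the exclusive or, in a form that evaluates quickly. -/
def xorCompletions (mask : ℕ) (l : List ℕ) (y : ℕ) : ℕ :=
  (l.map fun u => (l.map fun v => (mask.testBit (y ^^^ u ^^^ v)).toNat).sum).sum

lemma sum_maskFinset {k mask : ℕ} (F : ℕ → ℕ) :
    ∑ x ∈ maskFinset k mask, F x.val = (((List.range (2 ^ k)).filter mask.testBit).map F).sum := by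
  rw [maskFinset, Finset.sum_filter, Fin.sum_univ_eq_sum_range
    (fun x => if mask.testBit x = true then F x else 0), ← Finset.sum_filter,
    ← List.sum_toFinset F (List.nodup_range.filter _), List.toFinset_filter, List.toFinset_range]

lemma completions_maskFinset {k mask : ℕ} {l : List ℕ}
    (hl : (List.range (2 ^ k)).filter mask.testBit = l) (y : Fin (2 ^ k)) :
    completions (fun x y z => x ^^^ y ^^^ z) (maskFinset k mask) y =
      xorCompletions mask l y.val := by
  rw [completions, Finset.card_filter, Finset.sum_product, xorCompletions, ← hl, ← sum_maskFinset]
  refine Finset.sum_congr rfl fun u _ => ?_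
  rw [← sum_maskFinset]
  refine Finset.sum_congr rfl fun v _ => ?_
  simp only [maskFinset, Finset.mem_filter, Finset.mem_univ, true_and, Fin.xor_val_of_two_pow]
  cases mask.testBit (y.val ^^^ u.val ^^^ v.val) <;> rfl

lemma IsAffineIn.isOddFree_map_maskFinset {Ω : Type*} {k : ℕ} {e : Ω ≃ (Fin k → ZMod 2)}
    {G : Subgroup (Equiv.Perm Ω)} (h : IsAffineIn e G) {mask : ℕ} {l c : List ℕ}
    (hl : (List.range (2 ^ k)).filter mask.testBit = l)
    (hc : (List.range (2 ^ k)).map (xorCompletions mask l) = c) (h₀ : c.count (c.getD 0 0) ≤ 2)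
    (h₁ : ∀ i < k, c.count (c.getD (2 ^ i) 0) ≤ 2) :
    IsOddFree G ((maskFinset k mask).map ((bitsEquiv k).trans e.symm).toEmbedding) := by
  have hget : ∀ y : Fin (2 ^ k), c.getD y.val 0 = xorCompletions mask l y.val := fun y => by
    simp [← hc, List.getD_eq_getElem?_getD]
  have hcount : ∀ n, (Finset.univ.filter fun y : Fin (2 ^ k) => c.getD y.val 0 = n).card =
      c.count n := fun n => by
    simp only [hget]
    rw [Finset.card_filter, Fin.sum_univ_eq_sum_range
      (fun y => if xorCompletions mask l y = n then 1 else 0), ← Finset.card_filter, ← hc,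
      List.count, List.countP_map, List.countP_eq_length_filter,
      ← List.toFinset_card_of_nodup (List.nodup_range.filter _), List.toFinset_filter,
      List.toFinset_range]
    simp
  refine h.isOddFree_map (bitsEquiv k) bitsEquiv_xor (c := fun y => c.getD y.val 0)
    (fun y => by rw [hget, completions_maskFinset hl]) bitsEquiv_zero bitsEquiv_two_pow ?_
    fun i => ?_
  · rw [hcount]
    exact h₀
  · rw [hcount]
    exact h₁ i i.2

lemma IsAffineIn.isNice_of_two_five {Ω : Type*} [Fintype Ω] {e : Ω ≃ (Fin 5 → ZMod 2)}
    {G : Subgroup (Equiv.Perm Ω)} (h : IsAffineIn e G) : IsNice Ω G := by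
  have h₁ := h.isOddFree_map_maskFinset (mask := 1610943959)
    (l := [0, 1, 2, 4, 6, 7, 8, 10, 11, 16, 18, 29, 30])
    (c := [67, 67, 73, 54, 91, 72, 85, 85, 91, 72, 85, 85, 60, 60, 60, 54, 79, 72, 85, 66, 60, 48,
      54, 54, 60, 48, 54, 54, 72, 79, 85, 66])
    (by decide +kernel) (by decide +kernel) (by decide +kernel) (by decide +kernel)
  have h₂ := h.isOddFree_map_maskFinset (mask := 942253029)
    (l := [0, 2, 5, 6, 7, 8, 9, 13, 15, 16, 19, 21, 27, 28, 29])
    (c := [127, 102, 103, 90, 84, 109, 115, 121, 127, 115, 96, 90, 84, 109, 108, 121, 103, 90,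
      108, 121, 108, 121, 96, 90, 96, 90, 108, 121, 115, 121, 96, 90])
    (by decide +kernel) (by decide +kernel) (by decide +kernel) (by decide +kernel)
  exact isNice_of_isOddFree_map h₁ h₂ (by decide +kernel) (by decide +kernel)

lemma IsAffineIn.isNice_of_two_six {Ω : Type*} [Fintype Ω] {e : Ω ≃ (Fin 6 → ZMod 2)}
    {G : Subgroup (Equiv.Perm Ω)} (h : IsAffineIn e G) : IsNice Ω G := by
  have h₁ := h.isOddFree_map_maskFinset (mask := 1152939135716626711)
    (l := [0, 1, 2, 4, 8, 12, 16, 19, 28, 32, 35, 44, 60])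
    (c := [67, 49, 49, 42, 55, 12, 12, 30, 55, 12, 12, 30, 73, 36, 36, 42, 79, 24, 24, 61, 36, 18,
      18, 18, 36, 18, 18, 18, 73, 30, 30, 48, 79, 24, 24, 61, 36, 18, 18, 18, 36, 18, 18, 18, 73,
      30, 30, 48, 54, 36, 36, 36, 42, 6, 6, 24, 42, 6, 6, 24, 67, 30, 30, 42])
    (by decide +kernel) (by decide +kernel) (by decide +kernel) (by decide +kernel)
  have h₂ := h.isOddFree_map_maskFinset (mask := 288518620013724951)
    (l := [0, 1, 2, 4, 8, 10, 16, 24, 35, 37, 41, 42, 48, 58])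
    (c := [70, 64, 82, 36, 52, 18, 24, 30, 82, 42, 70, 54, 30, 30, 42, 18, 64, 54, 60, 42, 30, 18,
      18, 30, 76, 42, 48, 54, 18, 30, 30, 18, 66, 48, 54, 76, 18, 52, 30, 24, 48, 76, 76, 48, 30,
      30, 18, 42, 76, 42, 48, 54, 18, 30, 30, 18, 48, 54, 76, 42, 30, 18, 18, 30])
    (by decide +kernel) (by decide +kernel) (by decide +kernel) (by decide +kernel)
  exact isNice_of_isOddFree_map h₁ h₂ (by decide +kernel) (by decide +kernel)

lemma IsAffineIn.isNice_of_five_two {Ω : Type*} [Fintype Ω] {e : Ω ≃ (Fin 2 → ZMod 5)}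
    {G : Subgroup (Equiv.Perm Ω)} (h : IsAffineIn e G) : IsNice Ω G := by
  have h₁ := h.isOddFree_map (finTwoArrowEquiv (ZMod 5)).symm (op := fun x y z => x + y - z)
    (fun x y z => by ext i; fin_cases i <;> rfl)
    (D := {(0, 0), (1, 0), (0, 1), (2, 0)}) (fun y => rfl) (x₀ := 0) (b := ![(1, 0), (0, 1)])
    (by decide) (by decide) (by decide +kernel) (by decide +kernel)
  have h₂ := h.isOddFree_map (finTwoArrowEquiv (ZMod 5)).symm (op := fun x y z => x + y - z)
    (fun x y z => by ext i; fin_cases i <;> rfl)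
    (D := {(0, 0), (0, 1), (0, 2), (1, 0), (1, 1)}) (fun y => rfl) (x₀ := 0)
    (b := ![(1, 0), (0, 1)])
    (by decide) (by decide) (by decide +kernel) (by decide +kernel)
  exact isNice_of_isOddFree_map h₁ h₂ (by decide +kernel) (by decide +kernel)

/-- A nontrivial finite solvable group has a nontrivial normal elementary abelian subgroup. -/
lemma exists_normal_elementaryAbelian {G : Type*} [Group G] [Finite G] [Nontrivial G]
    (hG : Group.IsSolvable G) :
    ∃ (p : ℕ) (V : Subgroup G), p.Prime ∧ V.Normal ∧ V ≠ ⊥ ∧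
      (∀ x ∈ V, ∀ y ∈ V, x * y = y * x) ∧ ∀ x ∈ V, x ^ p = 1 := by
  classical
  obtain ⟨A, hAn, hA, hAc⟩ : ∃ A : Subgroup G, A.Normal ∧ A ≠ ⊥ ∧
      ∀ x ∈ A, ∀ y ∈ A, x * y = y * x := by
    have hex := hG.solvable
    set m := Nat.find hex with hm
    have hm0 : m ≠ 0 := by
      intro h
      have := Nat.find_spec hex
      rw [← hm, h, derivedSeries_zero] at this
      exact top_ne_bot this
    obtain ⟨j, hj⟩ := Nat.exists_eq_succ_of_ne_zero hm0
    refine ⟨derivedSeries G j, inferInstance, Nat.find_min hex (by omega), fun x hx y hy => ?_⟩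
    have h := Nat.find_spec hex
    rw [← hm, hj, derivedSeries_succ, Subgroup.commutator_eq_bot_iff_le_centralizer] at h
    exact (Subgroup.mem_centralizer_iff.1 (h hx) y hy).symm
  have hcard : Nat.card A ≠ 1 := by
    rwa [Ne, Subgroup.card_eq_one]
  obtain ⟨p, hp, hpd⟩ := Nat.exists_prime_and_dvd hcard
  have := Fact.mk hp
  obtain ⟨x, hx⟩ := exists_prime_orderOf_dvd_card' p hpd
  let V : Subgroup G :=
    { carrier := {x | x ∈ A ∧ x ^ p = 1}
      one_mem' := ⟨A.one_mem, one_pow p⟩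
      mul_mem' := fun {a b} ha hb => ⟨A.mul_mem ha.1 hb.1, by
        rw [(show Commute a b from hAc a ha.1 b hb.1).mul_pow, ha.2, hb.2, one_mul]⟩
      inv_mem' := fun {a} ha => ⟨A.inv_mem ha.1, by rw [inv_pow, ha.2, inv_one]⟩ }
  refine ⟨p, V, hp, ⟨fun v hv g => ⟨hAn.conj_mem v hv.1 g, ?_⟩⟩, fun h => ?_,
    fun a ha b hb => hAc a ha.1 b hb.1, fun a ha => ha.2⟩
  · rw [conj_pow, hv.2, mul_one, mul_inv_cancel]
  · have hxV : (x : G) ∈ V := ⟨x.2, by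
      rw [← Subgroup.coe_pow, ← hx, pow_orderOf_eq_one, Subgroup.coe_one]⟩
    rw [h, Subgroup.mem_bot, OneMemClass.coe_eq_one] at hxV
    rw [hxV, orderOf_one] at hx
    exact hp.one_lt.ne hx

lemma exists_equiv_zmod_pow {p : ℕ} [Fact p.Prime] {V : Type*} [Group V] [Finite V]
    (hcomm : ∀ a b : V, a * b = b * a) (hpow : ∀ x : V, x ^ p = 1) :
    ∃ (k : ℕ) (c : V ≃ (Fin k → ZMod p)), ∀ a b, c (a * b) = c a + c b := by
  let _ : AddCommGroup (Additive V) :=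
    { (inferInstance : AddGroup (Additive V)) with add_comm := hcomm }
  let _ : Module (ZMod p) (Additive V) := AddCommGroup.zmodModule (n := p) hpow
  let c := (Module.finBasis (ZMod p) (Additive V)).equivFun
  exact ⟨_, Additive.ofMul.trans c.toEquiv, fun a b => map_add c _ _⟩

/-- The points permuted by a solvable primitive group can be labelled by the vectors of a finite
vector space over a prime field so that the group acts by affine maps. -/
lemma exists_affine_coordinates {Ω : Type*} [Fintype Ω] (G : Subgroup (Equiv.Perm Ω))
    (hsolv : Group.IsSolvable G) (hprim : IsPrimitivePermGroup Ω G) (hcard : 1 < Fintype.card Ω) :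
    ∃ (p k : ℕ), p.Prime ∧ ∃ e : Ω ≃ (Fin k → ZMod p), IsAffineIn e G := by
  classical
  have := hprim.1
  have hpp : MulAction.IsPreprimitive G Ω := ⟨fun {B} hB => hprim.2 B hB⟩
  have hnt : Nontrivial Ω := Fintype.one_lt_card_iff_nontrivial.1 hcard
  obtain ⟨ω⟩ : Nonempty Ω := inferInstance
  have hG : Nontrivial G := by
    obtain ⟨b, hb⟩ := exists_ne ω
    obtain ⟨g, hg⟩ := MulAction.exists_smul_eq G ω b
    exact ⟨g, 1, fun h => hb (by rw [← hg, h, one_smul])⟩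
  obtain ⟨p, V, hp, hVn, hV, hVc, hVp⟩ := exists_normal_elementaryAbelian hsolv
  have := Fact.mk hp
  have hVt : MulAction.IsPretransitive V Ω := by
    refine MulAction.IsQuasiPreprimitive.isPretransitive_of_normal (N := V) fun h => hV ?_
    rw [Subgroup.eq_bot_iff_forall]
    intro v hv
    ext x
    have hx : x ∈ MulAction.fixedPoints V Ω := by rw [h]; trivial
    exact hx ⟨v, hv⟩
  have hcomm : ∀ a b : V, a * b = b * a := fun a b => Subtype.ext (hVc a a.2 b b.2)
  obtain ⟨k, c, hc⟩ := exists_equiv_zmod_pow (p := p) (V := V) hcomm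
    fun x => Subtype.ext (hVp x x.2)
  have hbij : Function.Bijective fun v : V => v • ω := by
    refine ⟨fun v w h => ?_, fun x => MulAction.exists_smul_eq V ω x⟩
    refine Subtype.ext (Subtype.ext (Equiv.ext fun x => ?_))
    obtain ⟨u, rfl⟩ := MulAction.exists_smul_eq V ω x
    change v • u • ω = w • u • ω
    rw [smul_smul, smul_smul, hcomm v, hcomm w, mul_smul, mul_smul]
    exact congrArg (u • ·) h
  let e : Ω ≃ (Fin k → ZMod p) :=
    (Equiv.ofBijective _ hbij).symm.trans c
  have he : ∀ (w : V) (z : Ω), e (w • z) = c w + e z := by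
    intro w z
    obtain ⟨u, rfl⟩ := hbij.2 z
    have h1 : ∀ u : V, e (u • ω) = c u := fun u => by
      have := (Equiv.ofBijective _ hbij).symm_apply_apply u
      simp only [Equiv.ofBijective_apply] at this
      simp only [e, Equiv.trans_apply, this]
    change e (w • u • ω) = _ + e (u • ω)
    rw [smul_smul, h1, h1, hc]
  refine ⟨p, k, hp, e, fun g hg => ?_⟩
  let s : (Fin k → ZMod p) → _ := fun x => e (g (e.symm x))
  have hs : ∀ x y, s (x + y) + s 0 = s x + s y := by
    intro x y
    let v : V := c.symm x
    have hv : c v = x := c.apply_symm_apply x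
    let w : V := ⟨⟨g, hg⟩ * v.1 * (⟨g, hg⟩ : G)⁻¹, hVn.conj_mem _ v.2 _⟩
    have h1 : ∀ z, s (x + z) = c w + s z := by
      intro z
      have h2 : e.symm (x + z) = v • e.symm z := by
        rw [Equiv.symm_apply_eq, he, hv, Equiv.apply_symm_apply]
      have h3 : g (v • e.symm z) = w • g (e.symm z) := by
        change g ((v.1 : Equiv.Perm Ω) (e.symm z)) =
          (g * (v.1 : Equiv.Perm Ω) * g⁻¹) (g (e.symm z))
        simp
      simp only [s, h2, h3, he]
    have h4 := h1 0
    rw [add_zero] at h4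
    rw [h1, h4]
    abel
  refine ⟨AddMonoidHom.mk' (fun x => s x - s 0) fun x y => ?_, s 0, fun x => ?_⟩
  · rw [sub_add_sub_comm, ← hs, add_sub_add_right_eq_sub]
  · simp [s]

/-- Lemma 2.2: a primitive solvable permutation group of degree ≥ 49, or of degree 25 or 32,
is nice. -/
theorem stmt_10 {Ω : Type*} [Fintype Ω] (G : Subgroup (Equiv.Perm Ω))
    (hsolv : IsSolvable G) (hprim : IsPrimitivePermGroup Ω G)
    (hcard : 49 ≤ Fintype.card Ω ∨ Fintype.card Ω = 25 ∨ Fintype.card Ω = 32) :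
    IsNice Ω G := by
  obtain ⟨p, k, hp, e, h⟩ := exists_affine_coordinates G hsolv hprim (by omega)
  have hpk : Fintype.card Ω = p ^ k := card_eq_pow_of_equiv e
  have hdvd : p ∣ Fintype.card Ω := by
    rw [hpk]
    refine dvd_pow_self p ?_
    rintro rfl
    rw [pow_zero] at hpk
    omega
  by_cases hp2 : p = 2
  · subst hp2
    rcases lt_or_ge k 7 with hk | hk
    · rw [hpk] at hcard
      interval_cases k <;> norm_num at hcard
      · exact h.isNice_of_two_five
      · exact h.isNice_of_two_six
    · exact h.isNice_of_two hk
  rcases hcard with hn | hn | hn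
  · exact h.isNice_of_ne_two hp hp2 hn
  · rw [hn] at hpk hdvd
    obtain rfl : p = 5 := (Nat.prime_dvd_prime_iff_eq hp Nat.prime_five).1 <|
      hp.dvd_of_dvd_pow (n := 2) (by norm_num [hdvd])
    obtain rfl : k = 2 := Nat.pow_right_injective (show 2 ≤ 5 by norm_num) hpk.symm
    exact h.isNice_of_five_two
  · rw [hn] at hdvd
    exact absurd ((Nat.prime_dvd_prime_iff_eq hp Nat.prime_two).1 <|
      hp.dvd_of_dvd_pow (n := 5) (by norm_num [hdvd])) hp2
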